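/- Let G be a finite connected simple graph of genus g = |E(G)| − |V(G)| + 1, and suppose g ≥ 2. Then gon(G) ≤ g. -/

import Mathlib

open SimpleGraph Finset

namespace GraphGonality

variable {V : Type*}

/-- The degree of a divisor: the sum of its values. -/
def degD [Fintype V] (D : V → ℤ) : ℤ := ∑ v, D v

/-- A divisor is effective if it is nonnegative at every vertex. -/
def Effective (D : V → ℤ) : Prop := ∀ v, 0 ≤ D v

/-- The graph Laplacian applied to an integer vector. -/
def lapply (G : SimpleGraph V) [Fintype V] [DecidableEq V] [DecidableRel G.Adj]
    (x : V → ℤ) : V → ℤ :=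
  fun v => (G.degree v : ℤ) * x v - ∑ w ∈ G.neighborFinset v, x w

/-- Two divisors are linearly equivalent if their difference lies in the image of the
Laplacian acting on `ℤ^V`. -/
def LinEquiv (G : SimpleGraph V) [Fintype V] [DecidableEq V] [DecidableRel G.Adj]
    (D D' : V → ℤ) : Prop :=
  ∃ x : V → ℤ, D - D' = lapply G x

/-- A divisor has positive rank if, for every vertex `v`, the divisor `D - 1_v` is
linearly equivalent to an effective divisor. -/
def PosRank (G : SimpleGraph V) [Fintype V] [DecidableEq V] [DecidableRel G.Adj]
    (D : V → ℤ) : Prop :=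
  ∀ v : V, ∃ E : V → ℤ, Effective E ∧
    LinEquiv G (fun w => D w - if w = v then 1 else 0) E

/-- The gonality of a graph: the smallest degree of a divisor of positive rank. -/
noncomputable def gonality (G : SimpleGraph V) [Fintype V] [DecidableEq V]
    [DecidableRel G.Adj] : ℤ :=
  sInf {d : ℤ | ∃ D : V → ℤ, PosRank G D ∧ degD D = d}

/-- The support of a divisor. -/
def suppD (D : V → ℤ) : Set V := {v | 0 < D v}

/-- The edge boundary of a set of vertices: edges with exactly one endpoint in `U`. -/
def edgeBoundary (G : SimpleGraph V) (U : Set V) : Set (Sym2 V) :=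
  {e | e ∈ G.edgeSet ∧ ∃ a b, e = s(a, b) ∧ a ∈ U ∧ b ∉ U}

/-- The Cheeger constant of a graph. -/
noncomputable def cheeger (G : SimpleGraph V) [Fintype V] : ℝ :=
  sInf {r : ℝ | ∃ U : Set V, U.Nonempty ∧ (U.ncard : ℝ) ≤ (Fintype.card V : ℝ) / 2 ∧
    r = (edgeBoundary G U).ncard / U.ncard}

/-- The `u`-Cheeger constant of a graph. -/
noncomputable def cheegerU (G : SimpleGraph V) [Fintype V] (u : ℝ) : ℝ :=
  sInf {r : ℝ | ∃ U : Set V, U.Nonempty ∧ (U.ncard : ℝ) ≤ u * (Fintype.card V : ℝ) ∧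
    r = (edgeBoundary G U).ncard / U.ncard}

/-- Every connected component of the induced subgraph on the complement of the support
of `D` has at most `u * |V|` vertices. -/
def ComponentsSmall (G : SimpleGraph V) [Fintype V] (D : V → ℤ) (u : ℝ) : Prop :=
  ∀ c : (G.induce (suppD D)ᶜ).ConnectedComponent,
    (c.supp.ncard : ℝ) ≤ u * (Fintype.card V : ℝ)

/-- `B_u(G)`: the smallest degree of an effective divisor all of whose complementary
components have size at most `u * |V|`. -/
noncomputable def Bu (G : SimpleGraph V) [Fintype V] (u : ℝ) : ℤ :=
  sInf {d : ℤ | ∃ D : V → ℤ, Effective D ∧ ComponentsSmall G D u ∧ degD D = d}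


section

variable [Fintype V] (G : SimpleGraph V) [DecidableRel G.Adj]

theorem sum_neighborFinset_comm (f : V → V → ℤ) :
    ∑ v, ∑ w ∈ G.neighborFinset v, f v w = ∑ v, ∑ w ∈ G.neighborFinset v, f w v := by
  simp only [neighborFinset_eq_filter, Finset.sum_filter]
  rw [Finset.sum_comm]
  simp only [G.adj_comm]

variable {G} in
theorem card_filter_lt_add_card_filter_gt {r : V → ℕ} (hr : Function.Injective r) (v : V) :
    #{w ∈ G.neighborFinset v | r w < r v} + #{w ∈ G.neighborFinset v | r v < r w} =
      G.degree v := by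
  rw [← G.card_neighborFinset_eq_degree,
    ← Finset.card_filter_add_card_filter_not (s := G.neighborFinset v) fun w => r w < r v]
  congr 2
  refine Finset.filter_congr fun w hw => ?_
  have : r v ≠ r w := hr.ne (G.ne_of_adj (by simpa using hw))
  omega

variable {G} in
theorem sum_card_filter_lt {r : V → ℕ} (hr : Function.Injective r) :
    ∑ v, (#{w ∈ G.neighborFinset v | r w < r v} : ℤ) = #G.edgeFinset := by
  have h1 : ∀ v, (#{w ∈ G.neighborFinset v | r w < r v} : ℤ) +
      #{w ∈ G.neighborFinset v | r v < r w} = G.degree v := fun v => by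
    exact_mod_cast card_filter_lt_add_card_filter_gt hr v
  have h2 : ∑ v, (#{w ∈ G.neighborFinset v | r w < r v} : ℤ) =
      ∑ v, (#{w ∈ G.neighborFinset v | r v < r w} : ℤ) := by
    simp only [Finset.card_filter]
    push_cast
    exact sum_neighborFinset_comm G _
  have h3 : ∑ v, (G.degree v : ℤ) = 2 * #G.edgeFinset := by
    exact_mod_cast G.sum_degrees_eq_twice_card_edges
  simp only [← h1, Finset.sum_add_distrib] at h3
  omega

variable [DecidableEq V]

theorem lapply_eq_sum (x : V → ℤ) (v : V) :
    lapply G x v = ∑ w ∈ G.neighborFinset v, (x v - x w) := by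
  simp [lapply, Finset.sum_sub_distrib]

theorem lapply_add (x y : V → ℤ) (v : V) :
    lapply G (x + y) v = lapply G x v + lapply G y v := by
  simp only [lapply_eq_sum, ← Finset.sum_add_distrib, Pi.add_apply]
  exact Finset.sum_congr rfl fun _ _ => by ring

theorem lapply_neg (x : V → ℤ) (v : V) : lapply G (-x) v = -lapply G x v := by
  simp only [lapply_eq_sum, ← Finset.sum_neg_distrib, Pi.neg_apply]
  exact Finset.sum_congr rfl fun _ _ => by ring

theorem degD_lapply (x : V → ℤ) : degD (lapply G x) = 0 := by
  simp only [degD, lapply_eq_sum, Finset.sum_sub_distrib]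
  rw [sum_neighborFinset_comm G fun v _ => x v, sub_self]

variable {G}

theorem LinEquiv.degD_eq {D D' : V → ℤ} (h : LinEquiv G D D') : degD D = degD D' := by
  obtain ⟨x, hx⟩ := h
  have h0 := degD_lapply G x
  rw [← hx] at h0
  simpa [degD, Finset.sum_sub_distrib, sub_eq_zero] using h0

/-- There are integer vectors whose Laplacian is arbitrarily large away from a vertex `q`. -/
theorem exists_le_lapply (hG : G.Connected) (q : V) (N : ℤ) :
    ∃ f : V → ℤ, ∀ v, v ≠ q → N ≤ lapply G f v := by
  set n := ∑ v, G.dist q v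
  set M : ℤ := |N| + Fintype.card V
  refine ⟨fun v => -M ^ (n - G.dist q v), fun v hv => ?_⟩
  have hdist : ∀ w, G.dist q w ≤ n := fun w =>
    Finset.single_le_sum (f := fun v => G.dist q v) (fun _ _ => Nat.zero_le _) (Finset.mem_univ w)
  have hcard : 0 < Fintype.card V := Fintype.card_pos_iff.2 ⟨q⟩
  have hM : 1 ≤ M := by have := abs_nonneg N; omega
  obtain ⟨p, hp⟩ := hG.exists_walk_length_eq_dist v q
  obtain ⟨u, hvu, hu⟩ : ∃ u, G.Adj v u ∧ G.dist q u + 1 = G.dist q v := by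
    cases p with
    | nil => exact absurd rfl hv
    | @cons _ u _ h p =>
      refine ⟨u, h, ?_⟩
      have h1 := dist_le p
      have h2 := hG.dist_triangle (u := v) (v := u) (w := q)
      rw [dist_eq_one_iff_adj.2 h] at h2
      rw [Walk.length_cons] at hp
      rw [G.dist_comm (u := q), G.dist_comm (u := q)]
      omega
  set P := M ^ (n - G.dist q v)
  have hP : 1 ≤ P := one_le_pow₀ hM
  have hPu : M ^ (n - G.dist q u) = P * M := by
    rw [← pow_succ]
    congr 1
    have := hdist v
    omega
  have hsum : ∑ w ∈ G.neighborFinset v, ((if w = u then P * M else 0) - P) ≤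
      lapply G (fun v => -M ^ (n - G.dist q v)) v := by
    rw [lapply_eq_sum]
    refine Finset.sum_le_sum fun w _ => ?_
    split_ifs with hw
    · subst hw
      simp only [hPu]
      linarith
    · have : 0 ≤ M ^ (n - G.dist q w) := by positivity
      linarith
  rw [Finset.sum_sub_distrib, Finset.sum_ite_eq', if_pos (by simpa using hvu), Finset.sum_const,
    card_neighborFinset_eq_degree, nsmul_eq_mul] at hsum
  have hdeg : (G.degree v : ℤ) < Fintype.card V := by exact_mod_cast G.degree_lt_card_verts v
  have := le_abs_self N
  have := abs_nonneg N
  nlinarith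

theorem lapply_nonneg_of_forall_le {x : V → ℤ} {v : V} (h : ∀ w, x w ≤ x v) :
    0 ≤ lapply G x v := by
  rw [lapply_eq_sum]
  exact Finset.sum_nonneg fun w _ => sub_nonneg.2 (h w)

/-- Every divisor on a connected graph is equivalent to a `q`-reduced one. -/
theorem exists_reduced (hG : G.Connected) (q : V) (D : V → ℤ) :
    ∃ x : V → ℤ, (∀ v, v ≠ q → 0 ≤ D v - lapply G x v) ∧
      ∀ S : Finset V, S.Nonempty → q ∉ S →
        ∃ v ∈ S, D v - lapply G x v < #{w ∈ G.neighborFinset v | w ∉ S} := by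
  obtain ⟨C, hC⟩ : ∃ C : ℤ, ∀ v, |D v| ≤ C :=
    ⟨∑ v, |D v|, fun v => Finset.single_le_sum (f := fun v => |D v|)
      (fun _ _ => abs_nonneg _) (Finset.mem_univ v)⟩
  obtain ⟨f, hf⟩ := exists_le_lapply hG q (C + 1)
  let A : Set (V → ℤ) := {x | x q = 0 ∧ ∀ v, v ≠ q → lapply G x v ≤ D v}
  have hbound : ∀ x ∈ A, ∑ v, x v ≤ ∑ v, (f v - f q) := by
    rintro x ⟨hxq, hx⟩
    have : Nonempty V := ⟨q⟩
    obtain ⟨u, hu⟩ := Finite.exists_max (x + -f)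
    have huq : u = q := by
      by_contra hne
      have h1 := lapply_nonneg_of_forall_le (G := G) hu
      rw [lapply_add, lapply_neg] at h1
      have := hx u hne
      have := hf u hne
      have := (abs_le.1 (hC u)).2
      omega
    subst huq
    refine Finset.sum_le_sum fun v _ => ?_
    have := hu v
    simp only [Pi.add_apply, Pi.neg_apply, hxq] at this
    linarith
  have hne : (fun v => f q - f v) ∈ A := by
    refine ⟨sub_self _, fun v hv => ?_⟩
    have h1 : lapply G (fun v => f q - f v) v = -lapply G f v := by
      rw [← lapply_neg, lapply_eq_sum, lapply_eq_sum]
      exact Finset.sum_congr rfl fun _ _ => by simp only [Pi.neg_apply]; ring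
    have := hf v hv
    have := (abs_le.1 (hC v)).1
    omega
  obtain ⟨_, ⟨x, ⟨hxq, hx⟩, rfl⟩, hmax⟩ := Int.exists_greatest_of_bdd
    (P := fun s => ∃ x ∈ A, ∑ v, x v = s)
    ⟨_, by rintro _ ⟨x, hx, rfl⟩; exact hbound x hx⟩ ⟨_, _, hne, rfl⟩
  refine ⟨x, fun v hv => sub_nonneg.2 (hx v hv), fun S hS hqS => ?_⟩
  by_contra! hcon
  let y : V → ℤ := fun v => if v ∈ S then 1 else 0
  have hy : x + y ∈ A := by
    refine ⟨by simp [y, hxq, hqS], fun v hv => ?_⟩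
    rw [lapply_add]
    by_cases hvS : v ∈ S
    · have h1 : lapply G y v = #{w ∈ G.neighborFinset v | w ∉ S} := by
        rw [lapply_eq_sum, Finset.card_filter]
        push_cast
        refine Finset.sum_congr rfl fun w _ => ?_
        by_cases hw : w ∈ S <;> simp [y, hvS, hw]
      have := hcon v hvS
      omega
    · have h1 : lapply G y v ≤ 0 := by
        rw [lapply_eq_sum]
        refine Finset.sum_nonpos fun w _ => ?_
        by_cases hw : w ∈ S <;> simp [y, hvS, hw]
      have := hx v hv
      omega
  have h1 := hmax _ ⟨_, hy, rfl⟩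
  have h2 : ∑ v, y v = #S := by simp [y]
  have h3 := hS.card_pos
  simp only [Pi.add_apply, Finset.sum_add_distrib] at h1
  omega

/-- Dhar's burning algorithm: `r` records the order in which the vertices burn. -/
theorem exists_burning_order {D : V → ℤ}
    (h : ∀ S : Finset V, S.Nonempty → ∃ v ∈ S, D v < #{w ∈ G.neighborFinset v | w ∉ S}) :
    ∃ r : V → ℕ, Function.Injective r ∧
      ∀ v, D v < #{w ∈ G.neighborFinset v | r w < r v} := by
  suffices key : ∀ (n : ℕ) (S : Finset V), #S = n → ∃ r : V → ℕ, (∀ v, v ∉ S ↔ r v = 0) ∧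
      Set.InjOn r S ∧ ∀ v ∈ S, D v < #{w ∈ G.neighborFinset v | r w < r v} by
    obtain ⟨r, -, hinj, hr⟩ := key _ Finset.univ rfl
    exact ⟨r, by simpa [Set.injOn_univ] using hinj, fun v => hr v (Finset.mem_univ v)⟩
  intro n
  induction n with
  | zero =>
    intro S hS
    rw [Finset.card_eq_zero] at hS
    subst hS
    exact ⟨0, by simp⟩
  | succ n ih =>
    intro S hS
    obtain ⟨v, hvS, hv⟩ := h S (Finset.card_pos.1 (by omega))
    obtain ⟨r, hr0, hinj, hr⟩ := ih (S.erase v) (by rw [Finset.card_erase_of_mem hvS]; omega)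
    have hrv : r v = 0 := (hr0 v).1 (Finset.notMem_erase v S)
    have hpos : ∀ u ∈ S, u ≠ v → r u ≠ 0 := fun u hu huv h0 =>
      (hr0 u).2 h0 (Finset.mem_erase.2 ⟨huv, hu⟩)
    refine ⟨fun w => if w ∈ S then r w + 1 else 0, fun w => by by_cases hw : w ∈ S <;> simp [hw],
      ?_, fun u hu => ?_⟩
    · intro a ha b hb hab
      rw [Finset.mem_coe] at ha hb
      simp only [ha, hb, if_true, add_left_inj] at hab
      by_cases hav : a = v <;> by_cases hbv : b = v
      · rw [hav, hbv]
      · exact absurd (by rw [← hab, hav, hrv]) (hpos b hb hbv)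
      · exact absurd (by rw [hab, hbv, hrv]) (hpos a ha hav)
      · exact hinj (by simp [hav, ha]) (by simp [hbv, hb]) hab
    · by_cases huv : u = v
      · subst huv
        refine hv.trans_le ?_
        gcongr with w _
        intro hw
        simp [hw, hu]
      · refine (hr u (Finset.mem_erase.2 ⟨huv, hu⟩)).trans_le ?_
        refine Nat.cast_le.2 (Finset.card_le_card (Finset.monotone_filter_right _ ?_))
        intro w _ hw
        by_cases hwS : w ∈ S <;> simp [hwS, hu, hw]

/-- The Laplacian of `x` dominates, at some vertex, the outdegree of the acyclic orientation
given by `r`. -/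
theorem exists_card_filter_gt_le_lapply [Nonempty V] (r : V → ℕ) (x : V → ℤ) :
    ∃ u, (#{w ∈ G.neighborFinset u | r u < r w} : ℤ) ≤ lapply G x u := by
  obtain ⟨u, hu⟩ := Finite.exists_max fun v => toLex (x v, r v)
  refine ⟨u, ?_⟩
  rw [lapply_eq_sum, Finset.card_filter]
  push_cast
  refine Finset.sum_le_sum fun w _ => ?_
  have := Prod.Lex.toLex_le_toLex.1 (hu w)
  simp only at this
  split_ifs <;> omega

/-- If `E` is effective of degree `g - 1`, then `K - E` is equivalent to an effective divisor,
where `K` is the canonical divisor. -/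
theorem exists_effective_linEquiv_canonical_sub (hG : G.Connected) {E : V → ℤ}
    (hE : Effective E) (hdeg : degD E = #G.edgeFinset - Fintype.card V) :
    ∃ F : V → ℤ, Effective F ∧ LinEquiv G (fun v => (G.degree v : ℤ) - 2 - E v) F := by
  have := hG.nonempty
  obtain ⟨q⟩ := hG.nonempty
  obtain ⟨x, hx, hred⟩ := exists_reduced hG q fun v => (G.degree v : ℤ) - 2 - E v
  set D : V → ℤ := fun v => (G.degree v : ℤ) - 2 - E v - lapply G x v with hD
  have hequiv : LinEquiv G (fun v => (G.degree v : ℤ) - 2 - E v) D :=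
    ⟨x, by ext v; simp [hD]⟩
  refine ⟨D, fun v => ?_, hequiv⟩
  by_cases hvq : v ≠ q
  · exact hx v hvq
  rw [not_not] at hvq
  subst hvq
  by_contra! hneg
  obtain ⟨r, hr, hlt⟩ := exists_burning_order (G := G) (D := D) fun S hS => by
    by_cases hqS : v ∈ S
    · exact ⟨v, hqS, hneg.trans_le (by positivity)⟩
    · exact hred S hS hqS
  have hK : ∑ v, (G.degree v : ℤ) = 2 * #G.edgeFinset := by
    exact_mod_cast G.sum_degrees_eq_twice_card_edges
  have hsum : ∑ v, (D v + 1) = ∑ v, (#{w ∈ G.neighborFinset v | r w < r v} : ℤ) := by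
    rw [sum_card_filter_lt hr]
    have h1 : degD D = _ := hequiv.degD_eq.symm
    simp only [degD, Finset.sum_sub_distrib, hK] at h1 hdeg
    simp only [Finset.sum_add_distrib, h1, hdeg]
    simp
    ring
  have heq := (Finset.sum_eq_sum_iff_of_le fun v _ => Int.add_one_le_iff.2 (hlt v)).1 hsum
  obtain ⟨u, hu⟩ := exists_card_filter_gt_le_lapply (G := G) r x
  have h1 := heq u (Finset.mem_univ u)
  have h2 := card_filter_lt_add_card_filter_gt (G := G) hr u
  have h3 := hE u
  simp only [hD] at h1
  omega

theorem bddBelow_degD_posRank [Nonempty V] :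
    BddBelow {d : ℤ | ∃ D : V → ℤ, PosRank G D ∧ degD D = d} := by
  refine ⟨1, ?_⟩
  rintro _ ⟨D, hD, rfl⟩
  obtain ⟨E, hE, h⟩ := hD (Classical.arbitrary V)
  have h1 : 0 ≤ degD E := Finset.sum_nonneg fun v _ => hE v
  rw [← h.degD_eq] at h1
  simpa [degD, Finset.sum_sub_distrib] using h1

end

/-- If `G` is a finite connected simple graph of genus `g = |E(G)| − |V(G)| + 1 ≥ 2`,
then `gon(G) ≤ g`. -/
theorem gonality_le_genus {V : Type*} [Fintype V] [DecidableEq V]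
    (G : SimpleGraph V) [DecidableRel G.Adj] (hG : G.Connected)
    (hg : 2 ≤ (G.edgeFinset.card : ℤ) - (Fintype.card V : ℤ) + 1) :
    gonality G ≤ (G.edgeFinset.card : ℤ) - (Fintype.card V : ℤ) + 1 := by
  have := hG.nonempty
  obtain ⟨q⟩ := hG.nonempty
  set g : ℤ := (G.edgeFinset.card : ℤ) - (Fintype.card V : ℤ) + 1 with hgdef
  refine csInf_le bddBelow_degD_posRank
    ⟨fun v => (G.degree v : ℤ) - 2 - if v = q then g - 2 else 0, fun v => ?_, ?_⟩
  · have hE : Effective fun w => (if w = q then g - 2 else 0) + if w = v then 1 else 0 := by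
      intro w
      dsimp only
      split_ifs <;> omega
    obtain ⟨F, hF, h⟩ := exists_effective_linEquiv_canonical_sub hG hE (by
      simp only [degD, Finset.sum_add_distrib, Finset.sum_ite_eq', Finset.mem_univ, if_true]
      omega)
    exact ⟨F, hF, by simpa only [sub_sub, add_assoc] using h⟩
  · have hK : ∑ v, (G.degree v : ℤ) = 2 * #G.edgeFinset := by
      exact_mod_cast G.sum_degrees_eq_twice_card_edges
    simp only [degD, Finset.sum_sub_distrib, hK, Finset.sum_ite_eq', Finset.mem_univ, if_true,
      Finset.sum_const, Finset.card_univ, nsmul_eq_mul]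
    omega

end GraphGonality
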